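/- For every r > 2 there is a constant C depending only on r such that the following holds for all ε ∈ (0,1], t ∈ [0,ε], τ > 0. Let w̄ = (w̄_ξ)_{ξ∈ℝ} be a family of continuously differentiable functions w̄_ξ : [0,∞) → ℂ and A = (A_ξ)_{ξ∈ℝ} ⊂ ℂ, for which all norms below are finite and all integrals converge absolutely. Define ℳ_ξ(y) = −i∫_ℝ η A_η I_y[θ_η] ∂_y w̄_{ξ−η}(y) dη and T_ℳ = ∫_ℝ∫_0^∞ ℳ_ξ(y) conj(w̄_ξ(y)) ρ(y)² e^{2τ|ξ|} ⟨ξ⟩^{2r} dy dξ. Then |T_ℳ| ≤ C ‖⟨∂ₓ⟩^{1/2} w̄‖_{τ,r} ‖⟨∂ₓ⟩^{1/2} A‖~_{τ,r} ( ‖∂_y w̄‖_{τ,r} + ‖yχ∂_y w̄‖_{τ,r−1/2} ). -/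

import Mathlib

open MeasureTheory Set Filter

noncomputable section

/-- Gaussian weight `ρ(y) = exp(y²/(8(1+t/ε)))`. -/
def rho (ε t y : ℝ) : ℝ := Real.exp (y ^ 2 / (8 * (1 + t / ε)))

/-- Japanese bracket `⟨ξ⟩ = √(1+ξ²)`. -/
def brak (ξ : ℝ) : ℝ := Real.sqrt (1 + ξ ^ 2)

/-- Combined weight `ρ(y)² e^{2τ|ξ|} ⟨ξ⟩^{2s}` in the squared analytic norms. -/
def wgt (ε t τ s ξ y : ℝ) : ℝ :=
  (rho ε t y) ^ 2 * Real.exp (2 * τ * |ξ|) * brak ξ ^ (2 * s)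

/-- Weight `e^{2τ|ξ|} ⟨ξ⟩^{2s}` for the squared analytic norms of boundary data. -/
def aWgt (τ s ξ : ℝ) : ℝ := Real.exp (2 * τ * |ξ|) * brak ξ ^ (2 * s)

/-- Analytic norm `‖w‖_{τ,s}` (with Fourier multiplier `m`):
`(∫_ℝ ∫_0^∞ m(ξ) ρ(y)² |w_ξ(y)|² e^{2τ|ξ|} ⟨ξ⟩^{2s} dy dξ)^{1/2}`. -/
def wNorm (ε t τ s : ℝ) (m : ℝ → ℝ) (w : ℝ → ℝ → ℂ) : ℝ :=
  Real.sqrt (∫ ξ : ℝ, ∫ y in Ioi (0 : ℝ), m ξ * ‖w ξ y‖ ^ 2 * wgt ε t τ s ξ y)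

/-- Analytic norm `‖A‖~_{τ,s}` (with Fourier multiplier `m`):
`(∫_ℝ m(ξ) |A_ξ|² e^{2τ|ξ|} ⟨ξ⟩^{2s} dξ)^{1/2}`. -/
def aNorm (τ s : ℝ) (m : ℝ → ℝ) (A : ℝ → ℂ) : ℝ :=
  Real.sqrt (∫ ξ : ℝ, m ξ * ‖A ξ‖ ^ 2 * aWgt τ s ξ)

/-- Finiteness of the squared norm `‖·‖_{τ,s}` with multiplier `m`. -/
def wFinite (ε t τ s : ℝ) (m : ℝ → ℝ) (w : ℝ → ℝ → ℂ) : Prop :=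
  Integrable (fun p : ℝ × ℝ => m p.1 * ‖w p.1 p.2‖ ^ 2 * wgt ε t τ s p.1 p.2)
    ((volume : Measure ℝ).prod ((volume : Measure ℝ).restrict (Ioi 0)))

/-- Finiteness of the squared norm `‖·‖~_{τ,s}` with multiplier `m`. -/
def aFinite (τ s : ℝ) (m : ℝ → ℝ) (A : ℝ → ℂ) : Prop :=
  Integrable (fun ξ : ℝ => m ξ * ‖A ξ‖ ^ 2 * aWgt τ s ξ) (volume : Measure ℝ)

/-- Lift function `θ_ξ(y) = 1 − exp(−y²⟨ξ⟩²/(2(1+t/ε)))`. -/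
def theta (ε t ξ y : ℝ) : ℝ :=
  1 - Real.exp (-(y ^ 2 * (1 + ξ ^ 2)) / (2 * (1 + t / ε)))

/-- `I_y[h] = ∫_0^y h` (real-valued version). -/
def IyR (h : ℝ → ℝ) (y : ℝ) : ℝ := ∫ y' in (0 : ℝ)..y, h y'

/-- The linear term `ℳ_ξ(w̄,A)(y) = −i∫ η A_η I_y[θ_η] ∂_y w̄_{ξ−η} dη`. -/
def Mcal (ε t : ℝ) (w : ℝ → ℝ → ℂ) (A : ℝ → ℂ) (ξ y : ℝ) : ℂ :=
  -Complex.I * ∫ η : ℝ,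
    (η : ℂ) * A η * ((IyR (theta ε t η) y : ℝ) : ℂ) * deriv (w (ξ - η)) y


lemma cs2 {X : Type*} [MeasurableSpace X] (μ : Measure X) {f g : X → ENNReal}
    (hf : AEMeasurable f μ) (hg : AEMeasurable g μ) :
    ∫⁻ x, f x * g x ∂μ ≤ (∫⁻ x, f x ^ 2 ∂μ) ^ (1/2 : ℝ) * (∫⁻ x, g x ^ 2 ∂μ) ^ (1/2 : ℝ) := by
  have := ENNReal.lintegral_mul_le_Lp_mul_Lq μ Real.HolderConjugate.two_two hf hg
  simpa using this

lemma sqrt_sq (x : ENNReal) : (x ^ (1/2 : ℝ)) ^ 2 = x := by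
  rw [← ENNReal.rpow_natCast, ← ENNReal.rpow_mul]; norm_num

lemma sq_sqrt' (x : ENNReal) : (x ^ 2) ^ (1/2 : ℝ) = x := by
  rw [← ENNReal.rpow_natCast, ← ENNReal.rpow_mul]; norm_num

lemma scal1 {f g h : ℝ → ENNReal} (hf : Measurable f) (hg : Measurable g) (hh : Measurable h) :
    ∫⁻ ξ, ∫⁻ η, f η * (g (ξ - η) * h ξ) ≤
      (∫⁻ x, f x) * ((∫⁻ x, g x ^ 2) ^ (1/2 : ℝ) * (∫⁻ x, h x ^ 2) ^ (1/2 : ℝ)) := by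
  rw [lintegral_lintegral_swap (by fun_prop)]
  rw [← lintegral_mul_const _ hf]
  refine lintegral_mono fun η => ?_
  dsimp only
  rw [lintegral_const_mul _ (by fun_prop)]
  gcongr
  refine (cs2 volume (by fun_prop) (by fun_prop)).trans ?_
  rw [lintegral_sub_right_eq_self (fun x => g x ^ 2) η]

lemma scal2 {f g h : ℝ → ENNReal} (hf : Measurable f) (hg : Measurable g) (hh : Measurable h) :
    ∫⁻ ξ, ∫⁻ η, f η * (g (ξ - η) * h ξ) ≤
      (∫⁻ x, g x) * ((∫⁻ x, f x ^ 2) ^ (1/2 : ℝ) * (∫⁻ x, h x ^ 2) ^ (1/2 : ℝ)) := by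
  refine le_trans (le_of_eq ?_) (scal1 hg hf hh)
  refine lintegral_congr fun ξ => ?_
  rw [← lintegral_sub_left_eq_self _ ξ]
  refine lintegral_congr fun η => ?_
  rw [sub_sub_cancel]; ring

lemma core0 (ν : Measure ℝ) [SFinite ν] {f : ℝ → ENNReal} {g u : ℝ × ℝ → ENNReal}
    (hf : Measurable f) (hg : Measurable g) (hu : Measurable u) :
    ∫⁻ ξ, ∫⁻ y, ∫⁻ η, f η * g (ξ - η, y) * u (ξ, y) ∂volume ∂ν ∂volume ≤
      ∫⁻ ξ, ∫⁻ η, f η * ((∫⁻ y, g (ξ - η, y) ^ 2 ∂ν) ^ (1/2 : ℝ)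
        * (∫⁻ y, u (ξ, y) ^ 2 ∂ν) ^ (1/2 : ℝ)) := by
  refine lintegral_mono fun ξ => ?_
  dsimp only
  rw [lintegral_lintegral_swap (by fun_prop)]
  refine lintegral_mono fun η => ?_
  simp only [mul_assoc]
  rw [lintegral_const_mul _ (by fun_prop)]
  gcongr
  exact cs2 ν (by fun_prop) (by fun_prop)

lemma measG (ν : Measure ℝ) [SFinite ν] {g : ℝ × ℝ → ENNReal} (hg : Measurable g) :
    Measurable fun ζ => (∫⁻ y, g (ζ, y) ^ 2 ∂ν) ^ (1/2 : ℝ) := by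
  have : Measurable fun ζ => (∫⁻ y, g (ζ, y) ^ 2 ∂ν) :=
    (hg.pow_const 2).lintegral_prod_right'
  fun_prop

lemma intG (ν : Measure ℝ) [SFinite ν] {g : ℝ × ℝ → ENNReal} (hg : Measurable g) :
    ∫⁻ ζ, ((∫⁻ y, g (ζ, y) ^ 2 ∂ν) ^ (1/2 : ℝ)) ^ 2 = ∫⁻ p, g p ^ 2 ∂(volume.prod ν) := by
  simp only [sqrt_sq]
  rw [lintegral_prod _ (by fun_prop)]

/-- The measurable trilinear bound. -/
lemma core (ν : Measure ℝ) [SFinite ν] {a b : ℝ → ENNReal} {g u : ℝ × ℝ → ENNReal}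
    (ha : Measurable a) (hb : Measurable b) (hg : Measurable g) (hu : Measurable u) :
    ∫⁻ ξ, ∫⁻ y, ∫⁻ η, (b η + b (ξ - η)) * (a η * g (ξ - η, y) * u (ξ, y)) ∂volume ∂ν ∂volume ≤
      2 * ((∫⁻ x, b x ^ 2) ^ (1/2 : ℝ) * (∫⁻ x, a x ^ 2) ^ (1/2 : ℝ) *
        (∫⁻ p, g p ^ 2 ∂(volume.prod ν)) ^ (1/2 : ℝ) *
        (∫⁻ p, u p ^ 2 ∂(volume.prod ν)) ^ (1/2 : ℝ)) := by
  have e : ∀ ξ y η, (b η + b (ξ - η)) * (a η * g (ξ - η, y) * u (ξ, y)) =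
      (b η * a η) * g (ξ - η, y) * u (ξ, y) +
        a η * (fun p : ℝ × ℝ => b p.1 * g p) (ξ - η, y) * u (ξ, y) := by
    intros; dsimp only; ring
  simp only [e]
  have m1 : Measurable fun q : (ℝ × ℝ) × ℝ =>
    (b q.2 * a q.2) * g (q.1.1 - q.2, q.1.2) * u (q.1.1, q.1.2) := by fun_prop
  have m1' : Measurable fun q : ℝ × ℝ =>
    ∫⁻ η, (b η * a η) * g (q.1 - η, q.2) * u (q.1, q.2) := m1.lintegral_prod_right'
  have m1'' : Measurable fun ξ : ℝ =>
    ∫⁻ y, ∫⁻ η, (b η * a η) * g (ξ - η, y) * u (ξ, y) ∂volume ∂ν := m1'.lintegral_prod_right'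
  have s1 : ∀ ξ y, ∫⁻ η, ((b η * a η) * g (ξ - η, y) * u (ξ, y) +
        a η * (fun p : ℝ × ℝ => b p.1 * g p) (ξ - η, y) * u (ξ, y)) =
      (∫⁻ η, (b η * a η) * g (ξ - η, y) * u (ξ, y)) +
      ∫⁻ η, a η * (fun p : ℝ × ℝ => b p.1 * g p) (ξ - η, y) * u (ξ, y) :=
    fun ξ y => lintegral_add_left (by fun_prop) _
  simp_rw [s1]
  have s2 : ∀ ξ, ∫⁻ y, ((∫⁻ η, (b η * a η) * g (ξ - η, y) * u (ξ, y)) +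
      ∫⁻ η, a η * (fun p : ℝ × ℝ => b p.1 * g p) (ξ - η, y) * u (ξ, y)) ∂ν =
      (∫⁻ y, (∫⁻ η, (b η * a η) * g (ξ - η, y) * u (ξ, y)) ∂ν) +
      ∫⁻ y, ∫⁻ η, a η * (fun p : ℝ × ℝ => b p.1 * g p) (ξ - η, y) * u (ξ, y) ∂volume ∂ν :=
    fun ξ => lintegral_add_left (m1'.comp (measurable_const.prodMk measurable_id)) _
  simp_rw [s2]
  rw [lintegral_add_left m1'', two_mul]
  have mG := measG ν hg
  have mU := measG ν hu
  have hbg : Measurable fun p : ℝ × ℝ => b p.1 * g p := by fun_prop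
  refine add_le_add ?_ ?_
  · refine (core0 ν (f := fun η => b η * a η) (by fun_prop) hg hu).trans ?_
    refine (scal1 (by fun_prop) mG mU).trans ?_
    rw [intG ν hg, intG ν hu, mul_assoc _ (_ ^ (1/2:ℝ)) (_ ^ (1/2:ℝ))]
    gcongr
    exact cs2 volume hb.aemeasurable ha.aemeasurable
  · refine (core0 ν (g := fun p : ℝ × ℝ => b p.1 * g p) ha hbg hu).trans ?_
    refine (scal2 ha (measG ν hbg) mU).trans ?_
    rw [intG ν hu]
    have : ∫⁻ x, (∫⁻ y, (b x * g (x, y)) ^ 2 ∂ν) ^ (1/2 : ℝ) ≤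
        (∫⁻ x, b x ^ 2) ^ (1/2 : ℝ) * (∫⁻ p, g p ^ 2 ∂(volume.prod ν)) ^ (1/2 : ℝ) := by
      rw [← intG ν hg]
      refine le_trans (le_of_eq ?_) (cs2 volume hb.aemeasurable mG.aemeasurable)
      refine lintegral_congr fun x => ?_
      simp only [mul_pow]
      rw [lintegral_const_mul _ (by fun_prop), ENNReal.mul_rpow_of_nonneg _ _ (by norm_num),
        sq_sqrt']
    calc _ ≤ _ := mul_le_mul_left this _
      _ = _ := by ring

/-- The trilinear bound for a.e. measurable functions. -/
lemma core_ae (ν : Measure ℝ) [SFinite ν] {a b : ℝ → ENNReal} {g u : ℝ × ℝ → ENNReal}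
    (ha : AEMeasurable a) (hb : Measurable b) (hg : AEMeasurable g (volume.prod ν))
    (hu : AEMeasurable u (volume.prod ν)) :
    ∫⁻ ξ, ∫⁻ y, ∫⁻ η, (b η + b (ξ - η)) * (a η * g (ξ - η, y) * u (ξ, y)) ∂volume ∂ν ∂volume ≤
      2 * ((∫⁻ x, b x ^ 2) ^ (1/2 : ℝ) * (∫⁻ x, a x ^ 2) ^ (1/2 : ℝ) *
        (∫⁻ p, g p ^ 2 ∂(volume.prod ν)) ^ (1/2 : ℝ) *
        (∫⁻ p, u p ^ 2 ∂(volume.prod ν)) ^ (1/2 : ℝ)) := by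
  have h := core ν ha.measurable_mk hb hg.measurable_mk hu.measurable_mk
  have ea : ∫⁻ x, a x ^ 2 = ∫⁻ x, ha.mk a x ^ 2 :=
    lintegral_congr_ae (ha.ae_eq_mk.mono fun x hx => by simp only [hx])
  have eg : ∫⁻ p, g p ^ 2 ∂(volume.prod ν) = ∫⁻ p, hg.mk g p ^ 2 ∂(volume.prod ν) :=
    lintegral_congr_ae (hg.ae_eq_mk.mono fun x hx => by simp only [hx])
  have eu : ∫⁻ p, u p ^ 2 ∂(volume.prod ν) = ∫⁻ p, hu.mk u p ^ 2 ∂(volume.prod ν) :=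
    lintegral_congr_ae (hu.ae_eq_mk.mono fun x hx => by simp only [hx])
  rw [ea, eg, eu]
  refine le_trans (le_of_eq ?_) h
  have g1 : ∀ᵐ y ∂ν, ∀ᵐ ζ, g (ζ, y) = hg.mk g (ζ, y) := by
    have : ∀ᵐ q ∂(ν.prod volume), g q.swap = hg.mk g q.swap :=
      (Measure.measurePreserving_swap (μ := ν) (ν := volume)).quasiMeasurePreserving.ae
        hg.ae_eq_mk
    exact Measure.ae_ae_of_ae_prod this
  have u1 := Measure.ae_ae_of_ae_prod hu.ae_eq_mk
  refine lintegral_congr_ae (u1.mono fun ξ hξ => ?_)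
  refine lintegral_congr_ae ?_
  filter_upwards [hξ, g1] with y hy1 hy2
  refine lintegral_congr_ae ?_
  have := (quasiMeasurePreserving_sub_left volume ξ).ae hy2
  filter_upwards [this, ha.ae_eq_mk] with η h1 h2
  rw [h1, h2, hy1]

lemma brak_one_le (ξ : ℝ) : 1 ≤ brak ξ := by
  unfold brak; rw [Real.one_le_sqrt]; nlinarith [sq_nonneg ξ]

lemma brak_pos (ξ : ℝ) : 0 < brak ξ := lt_of_lt_of_le one_pos (brak_one_le ξ)

lemma abs_le_brak (ξ : ℝ) : |ξ| ≤ brak ξ := by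
  unfold brak; exact Real.abs_le_sqrt (by linarith)

lemma brak_sq (ξ : ℝ) : brak ξ ^ 2 = 1 + ξ ^ 2 := Real.sq_sqrt (by positivity)

lemma brak_add (η ζ : ℝ) : brak (η + ζ) ≤ brak η + brak ζ := by
  have h1 := brak_sq η
  have h2 := brak_sq ζ
  have p1 := brak_pos η
  have p2 := brak_pos ζ
  have h3 : η * ζ ≤ brak η * brak ζ := by
    calc η * ζ ≤ |η * ζ| := le_abs_self _
      _ = |η| * |ζ| := abs_mul _ _
      _ ≤ _ := mul_le_mul (abs_le_brak η) (abs_le_brak ζ) (abs_nonneg _) p1.le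
  show Real.sqrt _ ≤ _
  rw [Real.sqrt_le_iff]
  constructor
  · positivity
  · nlinarith

lemma brak_pow (p η ζ : ℝ) (hp : 0 ≤ p) :
    brak (η + ζ) ^ p ≤ 2 ^ p * (brak η ^ p + brak ζ ^ p) := by
  have p1 := brak_pos η
  have p2 := brak_pos ζ
  have q1 : 0 ≤ brak η ^ p := Real.rpow_nonneg p1.le _
  have q2 : 0 ≤ brak ζ ^ p := Real.rpow_nonneg p2.le _
  have h := brak_add η ζ
  rcases le_total (brak η) (brak ζ) with hh | hh
  · calc _ ≤ (2 * brak ζ) ^ p := Real.rpow_le_rpow (brak_pos _).le (by linarith) hp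
      _ = 2 ^ p * brak ζ ^ p := Real.mul_rpow (by norm_num) p2.le
      _ ≤ _ := by gcongr; linarith
  · calc _ ≤ (2 * brak η) ^ p := Real.rpow_le_rpow (brak_pos _).le (by linarith) hp
      _ = 2 ^ p * brak η ^ p := Real.mul_rpow (by norm_num) p1.le
      _ ≤ _ := by gcongr; linarith

lemma IyR_bound (ε t η y : ℝ) (hε : 0 < ε) (ht : 0 ≤ t) (hy : 0 ≤ y) :
    |IyR (theta ε t η) y| ≤ y := by
  have h : ∀ x ∈ Set.uIoc 0 y, ‖theta ε t η x‖ ≤ 1 := by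
    intro x _
    have h0 : 0 ≤ t / ε := by positivity
    have h1 : Real.exp (-(x ^ 2 * (1 + η ^ 2)) / (2 * (1 + t / ε))) ≤ 1 := by
      rw [Real.exp_le_one_iff]
      apply div_nonpos_of_nonpos_of_nonneg
      · have : 0 ≤ x ^ 2 * (1 + η ^ 2) := by positivity
        linarith
      · positivity
    have h2 := Real.exp_pos (-(x ^ 2 * (1 + η ^ 2)) / (2 * (1 + t / ε)))
    unfold theta
    rw [Real.norm_eq_abs, abs_le]
    constructor <;> linarith
  have := intervalIntegral.norm_integral_le_of_norm_le_const h
  rw [Real.norm_eq_abs, one_mul, sub_zero, abs_of_nonneg hy] at this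
  exact this

lemma rho_pos (ε t y : ℝ) : 0 < rho ε t y := Real.exp_pos _

lemma wgt_nonneg (ε t τ s ξ y : ℝ) : 0 ≤ wgt ε t τ s ξ y := by
  unfold wgt
  have := (rho_pos ε t y).le
  have := Real.rpow_nonneg (brak_pos ξ).le (2 * s)
  positivity

lemma aWgt_nonneg (τ s ξ : ℝ) : 0 ≤ aWgt τ s ξ := by
  unfold aWgt
  have := Real.rpow_nonneg (brak_pos ξ).le (2 * s)
  positivity

lemma exp_two (τ x : ℝ) : Real.exp (2 * τ * x) = Real.exp (τ * x) ^ 2 := by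
  rw [← Real.exp_nat_mul]; congr 1; push_cast; ring

lemma brak_rpow_sq (ξ s : ℝ) : brak ξ ^ (2 * s) = (brak ξ ^ s) ^ 2 := by
  rw [mul_comm, Real.rpow_mul (brak_pos ξ).le]; norm_num

lemma brak_shift (ξ r : ℝ) :
    brak ξ * brak ξ ^ (2 * r) = (brak ξ ^ (r - 1/2 + 1)) ^ 2 := by
  rw [← brak_rpow_sq, show 2 * (r - 1/2 + 1) = 1 + 2 * r by ring, Real.rpow_add (brak_pos ξ),
    Real.rpow_one]

lemma pointwise (r ε t τ : ℝ) (hr : 2 < r) (hε : 0 < ε) (ht : 0 ≤ t) (hτ : 0 < τ)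
    (c : ℝ) (η ζ y : ℝ) (hy : 0 < y) (hc : 6 ≤ y → c = 1) (hc0 : 0 ≤ c)
    (A D W : ℝ) (hA : 0 ≤ A) (hD : 0 ≤ D) (hW : 0 ≤ W) :
    |η| * A * |IyR (theta ε t η) y| * D * W * wgt ε t τ r (η + ζ) y ≤
      2 ^ (r - 1/2) * ((brak η ^ (-(r - 1/2)) + brak ζ ^ (-(r - 1/2))) *
        (Real.sqrt (brak η * A ^ 2 * aWgt τ r η) *
        Real.sqrt (36 * (1 * D ^ 2 * wgt ε t τ r ζ y) +
          1 * (y * c * D) ^ 2 * wgt ε t τ (r - 1/2) ζ y) *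
        Real.sqrt (brak (η + ζ) * W ^ 2 * wgt ε t τ r (η + ζ) y))) := by
  set p := r - 1/2 with hp
  have hp0 : 0 < p := by rw [hp]; linarith
  have b1 := brak_pos η
  have b2 := brak_pos ζ
  have b3 := brak_pos (η + ζ)
  have hρ := rho_pos ε t y
  have P1 : 0 < brak η ^ p := Real.rpow_pos_of_pos b1 _
  have P2 : 0 < brak ζ ^ p := Real.rpow_pos_of_pos b2 _
  have P3 : 0 < brak (η + ζ) ^ p := Real.rpow_pos_of_pos b3 _
  have Q3 : 0 < brak (η + ζ) ^ (p + 1) := Real.rpow_pos_of_pos b3 _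
  have Q1 : 0 < brak η ^ (p + 1) := Real.rpow_pos_of_pos b1 _
  have E1 := Real.exp_pos (τ * |η|)
  have E2 := Real.exp_pos (τ * |ζ|)
  have E3 := Real.exp_pos (τ * |η + ζ|)
  have sA : Real.sqrt (brak η * A ^ 2 * aWgt τ r η) =
      brak η * brak η ^ p * Real.exp (τ * |η|) * A := by
    rw [show brak η * A ^ 2 * aWgt τ r η = (brak η ^ (p + 1) * Real.exp (τ * |η|) * A) ^ 2 by
      unfold aWgt
      rw [exp_two, mul_pow, mul_pow, ← brak_shift]; ring]
    rw [Real.sqrt_sq (by positivity), Real.rpow_add b1, Real.rpow_one]; ring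
  have sW : Real.sqrt (brak (η + ζ) * W ^ 2 * wgt ε t τ r (η + ζ) y) =
      brak (η + ζ) ^ (p + 1) * Real.exp (τ * |η + ζ|) * rho ε t y * W := by
    rw [show brak (η + ζ) * W ^ 2 * wgt ε t τ r (η + ζ) y =
      (brak (η + ζ) ^ (p + 1) * Real.exp (τ * |η + ζ|) * rho ε t y * W) ^ 2 by
      unfold wgt
      rw [exp_two, mul_pow, mul_pow, mul_pow, ← brak_shift]; ring]
    rw [Real.sqrt_sq (by positivity)]
  have sD : brak ζ ^ p * Real.exp (τ * |ζ|) * rho ε t y * (y * D) ≤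
      Real.sqrt (36 * (1 * D ^ 2 * wgt ε t τ r ζ y) +
          1 * (y * c * D) ^ 2 * wgt ε t τ p ζ y) := by
    apply Real.le_sqrt_of_sq_le
    have e : (brak ζ ^ p * Real.exp (τ * |ζ|) * rho ε t y * (y * D)) ^ 2 =
        (y * D) ^ 2 * wgt ε t τ p ζ y := by
      unfold wgt; rw [exp_two, brak_rpow_sq]; ring
    rw [e]
    have w0 := wgt_nonneg ε t τ p ζ y
    have w1 : wgt ε t τ p ζ y ≤ wgt ε t τ r ζ y := by
      unfold wgt
      have : brak ζ ^ (2 * p) ≤ brak ζ ^ (2 * r) :=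
        Real.rpow_le_rpow_of_exponent_le (brak_one_le ζ) (by rw [hp]; linarith)
      gcongr
    rcases le_total 6 y with h6 | h6
    · rw [hc h6]
      have : 0 ≤ 36 * (1 * D ^ 2 * wgt ε t τ r ζ y) := by
        have := w0.trans w1; positivity
      simp only [mul_one, one_mul] at *
      linarith
    · have h1 : (y * D) ^ 2 * wgt ε t τ p ζ y ≤ (6 * D) ^ 2 * wgt ε t τ r ζ y := by
        gcongr
      have : 0 ≤ 1 * (y * c * D) ^ 2 * wgt ε t τ p ζ y := by positivity
      nlinarith
  have eW : wgt ε t τ r (η + ζ) y = rho ε t y ^ 2 * Real.exp (τ * |η + ζ|) ^ 2 *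
      (brak (η + ζ) ^ p * brak (η + ζ) ^ (p + 1)) := by
    unfold wgt
    rw [exp_two, ← Real.rpow_add b3]
    congr 2
    rw [hp]; ring
  have hE : Real.exp (τ * |η + ζ|) ≤ Real.exp (τ * |η|) * Real.exp (τ * |ζ|) := by
    rw [← Real.exp_add, Real.exp_le_exp, ← mul_add]
    exact mul_le_mul_of_nonneg_left (abs_add_le η ζ) hτ.le
  have hB := brak_pow p η ζ hp0.le
  have hI := IyR_bound ε t η y hε ht hy.le
  have hη := abs_le_brak η
  rw [sA, sW]
  calc _ = |η| * A * |IyR (theta ε t η) y| * D * W * (rho ε t y ^ 2 *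
        (Real.exp (τ * |η + ζ|) * Real.exp (τ * |η + ζ|)) *
      (brak (η + ζ) ^ p * brak (η + ζ) ^ (p + 1))) := by rw [eW]; ring
    _ ≤ brak η * A * y * D * W * (rho ε t y ^ 2 *
        ((Real.exp (τ * |η|) * Real.exp (τ * |ζ|)) * Real.exp (τ * |η + ζ|)) *
      ((2 ^ p * (brak η ^ p + brak ζ ^ p)) * brak (η + ζ) ^ (p + 1))) := by gcongr
    _ = 2 ^ p * ((brak η ^ (-p) + brak ζ ^ (-p)) *
        (brak η * brak η ^ p * Real.exp (τ * |η|) * A *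
        (brak ζ ^ p * Real.exp (τ * |ζ|) * rho ε t y * (y * D)) *
        (brak (η + ζ) ^ (p + 1) * Real.exp (τ * |η + ζ|) * rho ε t y * W))) := by
        rw [Real.rpow_neg b1.le, Real.rpow_neg b2.le]
        field_simp
        ring
    _ ≤ _ := by
        have : 0 ≤ brak η ^ (-p) := Real.rpow_nonneg b1.le _
        have : 0 ≤ brak ζ ^ (-p) := Real.rpow_nonneg b2.le _
        gcongr

lemma meas_brak : Measurable brak := by
  unfold brak; fun_prop

lemma K_fin (r : ℝ) (hr : 2 < r) :
    ∫⁻ x, ENNReal.ofReal (brak x ^ (-(r - 1/2))) ^ 2 < ⊤ := by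
  have h := integrable_rpow_neg_one_add_norm_sq (E := ℝ) (μ := volume) (r := 2 * (r - 1/2))
    (by simp; linarith)
  refine lt_of_le_of_lt (le_of_eq ?_) h.lintegral_lt_top
  refine lintegral_congr fun x => ?_
  rw [← ENNReal.ofReal_pow (Real.rpow_nonneg (brak_pos x).le _), ← brak_rpow_sq]
  congr 1
  unfold brak
  rw [Real.sqrt_eq_rpow, ← Real.rpow_mul (by positivity), Real.norm_eq_abs, sq_abs]
  congr 1; ring

lemma lint_sqrt {X : Type*} [MeasurableSpace X] (μ : Measure X) {F : X → ℝ}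
    (hF : Integrable F μ) (h0 : ∀ x, 0 ≤ F x) :
    (∫⁻ x, ENNReal.ofReal (Real.sqrt (F x)) ^ 2 ∂μ) ^ (1/2 : ℝ) =
      ENNReal.ofReal (Real.sqrt (∫ x, F x ∂μ)) := by
  have : ∫⁻ x, ENNReal.ofReal (Real.sqrt (F x)) ^ 2 ∂μ = ENNReal.ofReal (∫ x, F x ∂μ) := by
    rw [ofReal_integral_eq_lintegral_ofReal hF (Eventually.of_forall h0)]
    refine lintegral_congr fun x => ?_
    rw [← ENNReal.ofReal_pow (Real.sqrt_nonneg _), Real.sq_sqrt (h0 x)]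
  rw [this, ENNReal.ofReal_rpow_of_nonneg (integral_nonneg h0) (by norm_num), Real.sqrt_eq_rpow]

lemma aem_sqrt {X : Type*} [MeasurableSpace X] (μ : Measure X) {F : X → ℝ}
    (hF : Integrable F μ) : AEMeasurable (fun x => ENNReal.ofReal (Real.sqrt (F x))) μ := by
  have := hF.aestronglyMeasurable.aemeasurable
  fun_prop

/-- **Bound (3.17c) of the paper** on `T_ℳ = ∫∫ ℳ_ξ conj(w̄_ξ) ρ² e^{2τ|ξ|}⟨ξ⟩^{2r} dy dξ`:
`|T_ℳ| ≤ C ‖⟨∂ₓ⟩^{1/2} w̄‖_{τ,r} ‖⟨∂ₓ⟩^{1/2} A‖~_{τ,r}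
(‖∂_y w̄‖_{τ,r} + ‖yχ∂_y w̄‖_{τ,r−1/2})` with `C = C(r)`. -/
theorem TM_bound :
    ∀ r : ℝ, 2 < r →
    ∃ C : ℝ, 0 < C ∧
    ∀ (ε t τ : ℝ), 0 < ε → ε ≤ 1 → 0 ≤ t → t ≤ ε → 0 < τ →
    ∀ χ : ℝ → ℝ, ContDiff ℝ (⊤ : ℕ∞) χ →
      (∀ y : ℝ, 0 ≤ χ y ∧ χ y ≤ 1) →
      (∀ y : ℝ, y ≤ 1 → χ y = 0) →
      (∀ y : ℝ, 6 ≤ y → χ y = 1) →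
      (∀ y : ℝ, 0 ≤ deriv χ y ∧ deriv χ y ≤ 1) →
    ∀ (w : ℝ → ℝ → ℂ) (A : ℝ → ℂ),
      (∀ ξ : ℝ, ContDiffOn ℝ 1 (w ξ) (Ici 0)) →
      wFinite ε t τ r brak w →
      aFinite τ r brak A →
      wFinite ε t τ r (fun _ => 1) (fun ξ y => deriv (w ξ) y) →
      wFinite ε t τ (r - 1 / 2) (fun _ => 1)
        (fun ξ y => ((y * χ y : ℝ) : ℂ) * deriv (w ξ) y) →
      Integrable (fun q : ℝ × ℝ × ℝ =>
        (q.2.1 : ℂ) * A q.2.1 * ((IyR (theta ε t q.2.1) q.2.2 : ℝ) : ℂ) *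
          deriv (w (q.1 - q.2.1)) q.2.2 *
          (starRingEnd ℂ) (w q.1 q.2.2) * ((wgt ε t τ r q.1 q.2.2 : ℝ) : ℂ))
        ((volume : Measure ℝ).prod
          ((volume : Measure ℝ).prod ((volume : Measure ℝ).restrict (Ioi 0)))) →
      ‖∫ ξ : ℝ, ∫ y in Ioi (0 : ℝ),
          Mcal ε t w A ξ y * (starRingEnd ℂ) (w ξ y) * ((wgt ε t τ r ξ y : ℝ) : ℂ)‖
        ≤ C * wNorm ε t τ r brak w * aNorm τ r brak A *
            (wNorm ε t τ r (fun _ => 1) (fun ξ y => deriv (w ξ) y)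
              + wNorm ε t τ (r - 1 / 2) (fun _ => 1)
                  (fun ξ y => ((y * χ y : ℝ) : ℂ) * deriv (w ξ) y)) := by
  intro r hr
  set K : ENNReal := (∫⁻ x, ENNReal.ofReal (brak x ^ (-(r - 1/2))) ^ 2) ^ (1/2 : ℝ) with hK
  have hKfin : K ≠ ⊤ := ENNReal.rpow_ne_top_of_nonneg (by norm_num) (K_fin r hr).ne
  have h2p : (0 : ℝ) < 2 ^ (r - 1/2) := by positivity
  refine ⟨2 ^ (r - 1/2) * (2 * (K.toReal * 6)) + 1, by positivity, ?_⟩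
  intro ε t τ hε hε1 ht htε hτ χ hχs hχ01 hχ0 hχ1 hχd w A hw fw fA fD fχ _
  set ν : Measure ℝ := (volume : Measure ℝ).restrict (Ioi 0) with hν
  set Fu : ℝ × ℝ → ℝ := fun p => brak p.1 * ‖w p.1 p.2‖ ^ 2 * wgt ε t τ r p.1 p.2 with hFu
  set Fa : ℝ → ℝ := fun ξ => brak ξ * ‖A ξ‖ ^ 2 * aWgt τ r ξ with hFa
  set F1 : ℝ × ℝ → ℝ := fun p => 1 * ‖deriv (w p.1) p.2‖ ^ 2 * wgt ε t τ r p.1 p.2 with hF1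
  set F2 : ℝ × ℝ → ℝ := fun p => 1 * ‖((p.2 * χ p.2 : ℝ) : ℂ) * deriv (w p.1) p.2‖ ^ 2 *
    wgt ε t τ (r - 1/2) p.1 p.2 with hF2
  have iu : Integrable Fu (volume.prod ν) := fw
  have ia : Integrable Fa := fA
  have i1 : Integrable F1 (volume.prod ν) := fD
  have i2 : Integrable F2 (volume.prod ν) := fχ
  have nu : ∀ p, 0 ≤ Fu p := fun p =>
    mul_nonneg (mul_nonneg (brak_pos _).le (sq_nonneg _)) (wgt_nonneg _ _ _ _ _ _)
  have na : ∀ p, 0 ≤ Fa p := fun p =>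
    mul_nonneg (mul_nonneg (brak_pos _).le (sq_nonneg _)) (aWgt_nonneg _ _ _)
  have n1 : ∀ p, 0 ≤ F1 p := fun p =>
    mul_nonneg (mul_nonneg zero_le_one (sq_nonneg _)) (wgt_nonneg _ _ _ _ _ _)
  have n2 : ∀ p, 0 ≤ F2 p := fun p =>
    mul_nonneg (mul_nonneg zero_le_one (sq_nonneg _)) (wgt_nonneg _ _ _ _ _ _)
  have ig : Integrable (fun p => 36 * F1 p + F2 p) (volume.prod ν) := (i1.const_mul 36).add i2
  have ng : ∀ p, 0 ≤ 36 * F1 p + F2 p := fun p => by linarith [n1 p, n2 p]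
  have eu : wNorm ε t τ r brak w = Real.sqrt (∫ p, Fu p ∂(volume.prod ν)) := by
    rw [integral_prod _ iu]; rfl
  have e1 : wNorm ε t τ r (fun _ => 1) (fun ξ y => deriv (w ξ) y) =
      Real.sqrt (∫ p, F1 p ∂(volume.prod ν)) := by
    rw [integral_prod _ i1]; rfl
  have e2 : wNorm ε t τ (r - 1/2) (fun _ => 1)
      (fun ξ y => ((y * χ y : ℝ) : ℂ) * deriv (w ξ) y) =
      Real.sqrt (∫ p, F2 p ∂(volume.prod ν)) := by
    rw [integral_prod _ i2]; rfl
  have ea : aNorm τ r brak A = Real.sqrt (∫ ξ, Fa ξ) := rfl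
  rw [eu, e1, e2, ea]
  set Nu := Real.sqrt (∫ p, Fu p ∂(volume.prod ν))
  set Na := Real.sqrt (∫ ξ, Fa ξ)
  set N1 := Real.sqrt (∫ p, F1 p ∂(volume.prod ν)) with hN1
  set N2 := Real.sqrt (∫ p, F2 p ∂(volume.prod ν)) with hN2
  have Nu0 : 0 ≤ Nu := Real.sqrt_nonneg _
  have Na0 : 0 ≤ Na := Real.sqrt_nonneg _
  have N10 : 0 ≤ N1 := Real.sqrt_nonneg _
  have N20 : 0 ≤ N2 := Real.sqrt_nonneg _
  have hG : Real.sqrt (∫ p, (36 * F1 p + F2 p) ∂(volume.prod ν)) ≤ 6 * (N1 + N2) := by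
    rw [integral_add (i1.const_mul 36) i2, integral_const_mul]
    rw [Real.sqrt_le_iff]
    have q1 : N1 ^ 2 = ∫ p, F1 p ∂(volume.prod ν) := Real.sq_sqrt (integral_nonneg n1)
    have q2 : N2 ^ 2 = ∫ p, F2 p ∂(volume.prod ν) := Real.sq_sqrt (integral_nonneg n2)
    rw [← q1, ← q2]
    constructor
    · positivity
    · nlinarith [mul_nonneg N10 N20]
  set b : ℝ → ENNReal := fun x => ENNReal.ofReal (brak x ^ (-(r - 1/2))) with hb
  set a : ℝ → ENNReal := fun x => ENNReal.ofReal (Real.sqrt (Fa x)) with hadef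
  set g : ℝ × ℝ → ENNReal := fun p => ENNReal.ofReal (Real.sqrt (36 * F1 p + F2 p)) with hg
  set u : ℝ × ℝ → ENNReal := fun p => ENNReal.ofReal (Real.sqrt (Fu p)) with hu
  have mb : Measurable b := by
    have := meas_brak
    rw [hb]; fun_prop
  have main := core_ae ν (a := a) (b := b) (g := g) (u := u) (aem_sqrt _ ia) mb
    (aem_sqrt _ ig) (aem_sqrt _ iu)
  rw [lint_sqrt _ ia na, lint_sqrt _ ig ng, lint_sqrt _ iu nu, ← hK] at main
  -- pointwise bound on the integrand
  have hpt : ∀ ξ, ∀ᵐ y ∂ν,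
      ‖Mcal ε t w A ξ y * (starRingEnd ℂ) (w ξ y) * ((wgt ε t τ r ξ y : ℝ) : ℂ)‖ₑ ≤
      ∫⁻ η, ENNReal.ofReal (2 ^ (r - 1/2)) *
        ((b η + b (ξ - η)) * (a η * g (ξ - η, y) * u (ξ, y))) := by
    intro ξ
    filter_upwards [ae_restrict_mem measurableSet_Ioi] with y hy
    have hy : 0 < y := hy
    rw [mul_assoc, enorm_mul]
    unfold Mcal
    rw [enorm_mul, enorm_neg]
    have hI : ‖Complex.I‖ₑ = 1 := by
      rw [← ofReal_norm_eq_enorm]; simp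
    rw [hI, one_mul]
    refine (mul_le_mul_left (enorm_integral_le_lintegral_enorm _) _).trans ?_
    rw [← lintegral_mul_const' _ _ enorm_ne_top]
    refine lintegral_mono fun η => ?_
    dsimp only
    have pw := pointwise r ε t τ hr hε ht hτ (χ y) η (ξ - η) y hy (hχ1 y) (hχ01 y).1
      ‖A η‖ ‖deriv (w (ξ - η)) y‖ ‖w ξ y‖ (norm_nonneg _) (norm_nonneg _) (norm_nonneg _)
    rw [add_sub_cancel] at pw
    have z1 := Real.rpow_nonneg (brak_pos η).le (-(r - 1/2))
    have z2 := Real.rpow_nonneg (brak_pos (ξ - η)).le (-(r - 1/2))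
    rw [← enorm_mul, ← ofReal_norm_eq_enorm]
    simp only [hb, hadef, hg, hu]
    rw [← ENNReal.ofReal_add z1 z2, ← ENNReal.ofReal_mul (Real.sqrt_nonneg _),
      ← ENNReal.ofReal_mul (by positivity), ← ENNReal.ofReal_mul (by positivity),
      ← ENNReal.ofReal_mul (by positivity)]
    apply ENNReal.ofReal_le_ofReal
    have hχn := (hχ01 y).1
    refine le_trans (le_of_eq ?_) (pw.trans (le_of_eq ?_))
    · simp only [norm_mul, Complex.norm_real, Real.norm_eq_abs, RCLike.norm_conj,
        abs_of_nonneg (wgt_nonneg ε t τ r ξ y)]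
      ring
    · simp only [hFa, hF1, hF2, hFu, norm_mul, Complex.norm_real, Real.norm_eq_abs,
        abs_of_nonneg hy.le, abs_of_nonneg hχn]
  have step : ‖∫ ξ : ℝ, ∫ y in Ioi (0 : ℝ),
          Mcal ε t w A ξ y * (starRingEnd ℂ) (w ξ y) * ((wgt ε t τ r ξ y : ℝ) : ℂ)‖ₑ ≤
      ENNReal.ofReal (2 ^ (r - 1/2)) * ∫⁻ ξ, ∫⁻ y, ∫⁻ η,
        (b η + b (ξ - η)) * (a η * g (ξ - η, y) * u (ξ, y)) ∂volume ∂ν ∂volume := by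
    refine (enorm_integral_le_lintegral_enorm _).trans ?_
    rw [← lintegral_const_mul' _ _ ENNReal.ofReal_ne_top]
    refine lintegral_mono fun ξ => ?_
    dsimp only
    refine (enorm_integral_le_lintegral_enorm _).trans ?_
    rw [← lintegral_const_mul' _ _ ENNReal.ofReal_ne_top]
    refine lintegral_mono_ae ((hpt ξ).mono fun y hy => hy.trans (le_of_eq ?_))
    rw [lintegral_const_mul' _ _ ENNReal.ofReal_ne_top]
  have fin := step.trans (mul_le_mul_right main _)
  have Kr : K = ENNReal.ofReal K.toReal := (ENNReal.ofReal_toReal hKfin).symm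
  have K0 : 0 ≤ K.toReal := ENNReal.toReal_nonneg
  rw [Kr, show (2 : ENNReal) = ENNReal.ofReal 2 by simp, ← ENNReal.ofReal_mul K0,
    ← ENNReal.ofReal_mul (by positivity), ← ENNReal.ofReal_mul (by positivity),
    ← ENNReal.ofReal_mul (by positivity), ← ENNReal.ofReal_mul (by positivity),
    ← ofReal_norm_eq_enorm, ENNReal.ofReal_le_ofReal_iff (by positivity)] at fin
  refine fin.trans ?_
  calc _ ≤ 2 ^ (r - 1/2) * (2 * (K.toReal * Na * (6 * (N1 + N2)) * Nu)) := by gcongr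
    _ = (2 ^ (r - 1/2) * (2 * (K.toReal * 6))) * Nu * Na * (N1 + N2) := by ring
    _ ≤ _ := by gcongr; linarith
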